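/- arXiv:2005.12583 — 2 statements merged into one kernel-verified Lean document; each statement's English description precedes it below -/
import Mathlib

section
/- (Quantified Ingham theorem, Theorem 1.3 of the paper.) Let X be a complex Banach space and let g : [0,∞) → X be bounded, continuous and Lipschitz. Suppose the Laplace transform ĝ admits a boundary function F : ℝ → X, i.e. F is locally Bochner-integrable and for every continuous compactly supported ψ : ℝ → ℝ, lim_{ε→0⁺} ∫_ℝ ĝ(ε+iη) ψ(η) dη = ∫_ℝ F(η) ψ(η) dη. Suppose moreover that for some k ∈ ℕ the function F is k times continuously differentiable and there is C > 0 with ‖F⁽ʲ⁾(η)‖_X ≤ C for all η ∈ ℝ and all 0 ≤ j ≤ k. Then there exist constants C' > 0 and t₀ > 0 such that ‖g(t)‖_X ≤ C'·t^{−k/2} for all t ≥ t₀. -/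
open MeasureTheory Filter

section Ingham

open scoped FourierTransform Topology ContDiff

variable {X : Type*} [NormedAddCommGroup X] [NormedSpace ℂ X]

/-- Integration by parts: a `C^k` function supported in `[-r, r]` whose `k`-th derivative is
bounded by `D` has a Fourier transform of size `O(|x| ^ (-k))`. -/
lemma norm_fourier_le_of_norm_iteratedDeriv_le {H : ℝ → X} {k : ℕ} {r D : ℝ}
    (hH : ContDiff ℝ k H) (hr : 0 ≤ r) (hsupp : tsupport H ⊆ Set.Icc (-r) r)
    (hD : ∀ x, ‖iteratedDeriv k H x‖ ≤ D) (x : ℝ) :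
    |2 * Real.pi * x| ^ k * ‖𝓕 H x‖ ≤ 2 * r * D := by
  have hvanish : ∀ (n : ℕ) (y : ℝ), y ∉ Set.Icc (-r) r → iteratedDeriv n H y = 0 := by
    intro n y hy
    rw [← norm_eq_zero, ← norm_iteratedFDeriv_eq_norm_iteratedDeriv, norm_eq_zero]
    by_contra h
    exact hy (hsupp (support_iteratedFDeriv_subset n h))
  have hint : ∀ n : ℕ, (n : ℕ∞) ≤ (k : ℕ∞) → Integrable (iteratedDeriv n H) := by
    intro n hn
    refine (hH.continuous_iteratedDeriv n (by exact_mod_cast hn)).integrable_of_hasCompactSupport ?_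
    exact HasCompactSupport.intro isCompact_Icc (fun y hy => hvanish n y hy)
  have hft := congrFun (Real.fourier_iteratedDeriv (N := (k : ℕ∞)) (n := k)
    (by exact_mod_cast hH) hint le_rfl) x
  have h1 : |2 * Real.pi * x| ^ k * ‖𝓕 H x‖ = ‖𝓕 (iteratedDeriv k H) x‖ := by
    rw [hft, norm_smul, norm_pow]
    congr 2
    simp [abs_mul]
  rw [h1]
  calc ‖𝓕 (iteratedDeriv k H) x‖ ≤ ∫ v, ‖iteratedDeriv k H v‖ :=
        VectorFourier.norm_fourierIntegral_le_integral_norm _ _ _ _ _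
    _ = ∫ v in Set.Icc (-r) r, ‖iteratedDeriv k H v‖ := by
        refine (setIntegral_eq_integral_of_forall_compl_eq_zero fun y hy => ?_).symm
        rw [hvanish k y hy, norm_zero]
    _ ≤ ∫ _ in Set.Icc (-r) r, D :=
        setIntegral_mono (hint k le_rfl).norm.integrableOn (by simp) hD
    _ = 2 * r * D := by
        rw [setIntegral_const, measureReal_def, Real.volume_Icc,
          ENNReal.toReal_ofReal (by linarith), smul_eq_mul]
        ring

/-- The Fourier transform of a modulated dilation. -/
lemma fourier_modulate_dilate (ψ : ℝ → ℂ) {R : ℝ} (hR : 0 < R) (t s : ℝ) :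
    𝓕 (fun v : ℝ => Real.fourierChar (v * t) • ψ (v / R)) s = R • 𝓕 ψ (R * (s - t)) := by
  rw [Real.fourier_real_eq, Real.fourier_real_eq]
  have := Measure.integral_comp_div
    (fun w : ℝ => Real.fourierChar (-(w * (R * (s - t)))) • ψ w) R
  rw [abs_of_pos hR] at this
  rw [← this]
  refine integral_congr_ae (.of_forall fun v => ?_)
  simp only
  rw [smul_smul, ← AddChar.map_add_eq_mul]
  congr 2
  field_simp
  ring

/-- Mollification of a function that is Lipschitz at the point `t` costs `O(1 / R)`. -/
lemma norm_sub_integral_dilate_le [CompleteSpace X] {φ : ℝ → ℂ} (hφ : Integrable φ)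
    (hφ' : Integrable fun u : ℝ => |u| * ‖φ u‖) (hone : ∫ u, φ u = 1)
    {G : ℝ → X} (hG : AEStronglyMeasurable G) {A M t R : ℝ} (hM : ∀ s, ‖G s‖ ≤ M)
    (hA : ∀ s, ‖G t - G s‖ ≤ A * |s - t|) (hR : 0 < R) :
    ‖G t - ∫ s, (R • φ (R * (s - t))) • G s‖ ≤ A * (∫ u, |u| * ‖φ u‖) / R := by
  have hφR : Integrable fun s : ℝ => R • φ (R * (s - t)) :=
    ((hφ.comp_mul_left' hR.ne').comp_sub_right t).smul R
  have htot : ∫ s, R • φ (R * (s - t)) = 1 := by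
    rw [integral_smul, integral_sub_right_eq_self (fun s => φ (R * s)) t,
      Measure.integral_comp_mul_left, hone, abs_of_pos (inv_pos.2 hR), smul_smul,
      mul_inv_cancel₀ hR.ne', one_smul]
  have hφG : Integrable fun s : ℝ => (R • φ (R * (s - t))) • G s :=
    hφR.smul_of_top_left (memLp_top_of_bound hG M (.of_forall hM))
  have hφabs : Integrable fun s : ℝ => |R * (s - t)| * ‖φ (R * (s - t))‖ :=
    (hφ'.comp_mul_left' hR.ne').comp_sub_right t
  have hEq : G t - ∫ s, (R • φ (R * (s - t))) • G s
      = ∫ s, (R • φ (R * (s - t))) • (G t - G s) := by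
    simp_rw [smul_sub]
    rw [integral_sub (hφR.smul_const _) hφG, integral_smul_const, htot, one_smul]
  rw [hEq]
  calc ‖∫ s, (R • φ (R * (s - t))) • (G t - G s)‖
      ≤ ∫ s, A * (|R * (s - t)| * ‖φ (R * (s - t))‖) := by
        refine norm_integral_le_of_norm_le (hφabs.const_mul A) (.of_forall fun s => ?_)
        rw [norm_smul, norm_smul, Real.norm_eq_abs, abs_mul]
        calc |R| * ‖φ (R * (s - t))‖ * ‖G t - G s‖
            ≤ |R| * ‖φ (R * (s - t))‖ * (A * |s - t|) := by gcongr; exact hA s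
          _ = _ := by ring
    _ = A * (∫ u, |u| * ‖φ u‖) / R := by
        rw [integral_const_mul,
          integral_sub_right_eq_self (fun s => |R * s| * ‖φ (R * s)‖) t,
          Measure.integral_comp_mul_left (fun s => |s| * ‖φ s‖), abs_of_pos (inv_pos.2 hR),
          smul_eq_mul]
        field_simp

/-- Uniform bounds on derivatives of products with dilated cutoffs. -/
lemma exists_norm_iteratedDeriv_dilate_smul_le {ψ : ℝ → ℂ} (hψ : ContDiff ℝ ∞ ψ)
    (hψc : HasCompactSupport ψ) {F : ℝ → X} {k : ℕ} (hF : ContDiff ℝ k F) {C : ℝ}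
    (hC : ∀ j ≤ k, ∀ x, ‖iteratedDeriv j F x‖ ≤ C) :
    ∃ D, ∀ R, 1 ≤ R → ∀ x, ‖iteratedDeriv k (fun v => ψ (v / R) • F v) x‖ ≤ D := by
  have hb : ∀ i : ℕ, ∃ B, ∀ x, ‖iteratedDeriv i ψ x‖ ≤ B := by
    intro i
    obtain ⟨B, hB⟩ := (hψc.iteratedFDeriv (𝕜 := ℝ) i).exists_bound_of_continuous
      (hψ.continuous_iteratedFDeriv (by exact_mod_cast le_top))
    exact ⟨B, fun x => by rw [← norm_iteratedFDeriv_eq_norm_iteratedDeriv]; exact hB x⟩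
  choose B hB using hb
  refine ⟨∑ i ∈ Finset.range (k + 1), (k.choose i : ℝ) * B i * C, fun R hR x => ?_⟩
  have hψR : ContDiff ℝ k fun v : ℝ => ψ (v / R) :=
    (hψ.of_le (by exact_mod_cast le_top)).comp (contDiff_id.div_const R)
  rw [← norm_iteratedFDeriv_eq_norm_iteratedDeriv]
  refine (norm_iteratedFDeriv_smul_le hψR hF x le_rfl).trans (Finset.sum_le_sum fun i _ => ?_)
  have h1 : ‖iteratedFDeriv ℝ i (fun v : ℝ => ψ (v / R)) x‖ ≤ B i := by
    rw [norm_iteratedFDeriv_eq_norm_iteratedDeriv]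
    have : (fun v : ℝ => ψ (v / R)) = fun v => ψ (R⁻¹ * v) := by
      ext v; rw [div_eq_inv_mul]
    rw [this, iteratedDeriv_comp_const_smul (hψ.of_le (by exact_mod_cast le_top)), norm_smul,
      norm_pow, Real.norm_eq_abs, abs_of_nonneg (by positivity)]
    calc R⁻¹ ^ i * ‖iteratedDeriv i ψ (R⁻¹ * x)‖ ≤ 1 * ‖iteratedDeriv i ψ (R⁻¹ * x)‖ := by
          gcongr
          exact pow_le_one₀ (by positivity) (inv_le_one_of_one_le₀ hR)
      _ ≤ B i := by rw [one_mul]; exact hB i _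
  have h2 : ‖iteratedFDeriv ℝ (k - i) F x‖ ≤ C := by
    rw [norm_iteratedFDeriv_eq_norm_iteratedDeriv]
    exact hC _ (Nat.sub_le _ _) x
  have h3 : 0 ≤ B i := (norm_nonneg _).trans (hB i 0)
  gcongr


/-- The Laplace transform on the line `Re λ = ε` is a Fourier transform. -/
lemma laplace_eq_fourier_indicator (g : ℝ → X) (ε v : ℝ) :
    ∫ t in Set.Ioi (0 : ℝ),
        Complex.exp (-((ε : ℂ) + ((2 * Real.pi * v : ℝ) : ℂ) * Complex.I) * (t : ℂ)) • g t
      = 𝓕 (fun s : ℝ => Complex.exp (-(ε : ℂ) * s) • (Set.Ioi (0 : ℝ)).indicator g s) v := by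
  rw [Real.fourier_real_eq_integral_exp_smul, ← integral_indicator measurableSet_Ioi]
  refine integral_congr_ae (.of_forall fun t => ?_)
  by_cases ht : t ∈ Set.Ioi (0 : ℝ)
  · simp only [Set.indicator_of_mem ht, smul_smul, ← Complex.exp_add]
    congr 2
    push_cast
    ring
  · simp only [Set.indicator_of_notMem ht, smul_zero]

/-- The damped extension by zero of a bounded function is integrable. -/
lemma integrable_exp_smul_indicator {g : ℝ → X} {M : ℝ} (hM : ∀ t, 0 ≤ t → ‖g t‖ ≤ M)
    (hg : AEStronglyMeasurable ((Set.Ioi (0 : ℝ)).indicator g)) {ε : ℝ} (hε : 0 < ε) :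
    Integrable fun s : ℝ => Complex.exp (-(ε : ℂ) * s) • (Set.Ioi (0 : ℝ)).indicator g s := by
  have hexp : Integrable ((Set.Ioi (0 : ℝ)).indicator fun s : ℝ => M * Real.exp (-ε * s)) :=
    (integrable_indicator_iff measurableSet_Ioi).2
      ((integrableOn_exp_mul_Ioi (by linarith) 0).const_mul M)
  refine hexp.mono' (AEStronglyMeasurable.smul (by fun_prop) hg) (.of_forall fun s => ?_)
  by_cases hs : s ∈ Set.Ioi (0 : ℝ)
  · rw [Set.indicator_of_mem hs, Set.indicator_of_mem hs, norm_smul, Complex.norm_exp, mul_comm]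
    have : (-(ε : ℂ) * s).re = -ε * s := by simp
    rw [this]
    gcongr
    exact hM s (le_of_lt hs)
  · simp [Set.indicator_of_notMem hs]

/-- The boundary function of the Laplace transform is, in the sense of distributions, the Fourier
transform of the extension by zero, for test functions with integrable Fourier transform. -/
lemma integral_fourier_smul_indicator_eq [CompleteSpace X] {g : ℝ → X} {M : ℝ}
    (hM : ∀ t, 0 ≤ t → ‖g t‖ ≤ M)
    (hg : AEStronglyMeasurable ((Set.Ioi (0 : ℝ)).indicator g)) {F : ℝ → X} (hF : Continuous F)
    (hlim : ∀ ψ : ℝ → ℝ, Continuous ψ → HasCompactSupport ψ →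
      Tendsto
        (fun ε : ℝ => ∫ η : ℝ, (ψ η : ℂ) •
          (∫ t in Set.Ioi (0 : ℝ),
            Complex.exp (-((ε : ℂ) + (η : ℂ) * Complex.I) * (t : ℂ)) • g t))
        (nhdsWithin 0 (Set.Ioi 0))
        (nhds (∫ η : ℝ, (ψ η : ℂ) • F η)))
    {χ : ℝ → ℂ} (hχ : Continuous χ) (hχc : HasCompactSupport χ) (hχF : Integrable (𝓕 χ)) :
    ∫ s, 𝓕 χ s • (Set.Ioi (0 : ℝ)).indicator g s = ∫ v, χ v • F (2 * Real.pi * v) := by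
  have hpi : (0 : ℝ) < 2 * Real.pi := by positivity
  set G : ℝ → X := (Set.Ioi (0 : ℝ)).indicator g with hG
  set Gε : ℝ → ℝ → X := fun ε s => Complex.exp (-(ε : ℂ) * s) • G s with hGε
  have hGint : ∀ ε, 0 < ε → Integrable (Gε ε) :=
    fun ε hε => integrable_exp_smul_indicator hM hg hε
  have hFcont : ∀ ε, 0 < ε → Continuous (𝓕 (Gε ε)) := fun ε hε =>
    VectorFourier.fourierIntegral_continuous Real.continuous_fourierChar
      (by exact continuous_inner) (hGint ε hε)
  have hreal : ∀ ρ : ℝ → ℝ, Continuous ρ → HasCompactSupport ρ →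
      Tendsto (fun ε : ℝ => ∫ v, (ρ v : ℂ) • 𝓕 (Gε ε) v) (𝓝[>] 0)
        (𝓝 (∫ v, (ρ v : ℂ) • F (2 * Real.pi * v))) := by
    intro ρ hρ hρc
    have h := hlim (fun η => ρ (η / (2 * Real.pi))) (by fun_prop)
      (hρc.comp_homeomorph (Homeomorph.mulRight₀ (2 * Real.pi)⁻¹ (by positivity)))
    have hsub : ∀ f : ℝ → X, ∫ η, (ρ (η / (2 * Real.pi)) : ℂ) • f η
        = (2 * Real.pi) • ∫ v, (ρ v : ℂ) • f (2 * Real.pi * v) := by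
      intro f
      have := Measure.integral_comp_div (fun v => (ρ v : ℂ) • f (2 * Real.pi * v)) (2 * Real.pi)
      rw [abs_of_pos hpi] at this
      rw [← this]
      refine integral_congr_ae (.of_forall fun v => ?_)
      simp only [mul_div_cancel₀ v hpi.ne']
    simp_rw [hsub, laplace_eq_fourier_indicator] at h
    have h' := h.const_smul (2 * Real.pi)⁻¹
    simpa only [smul_smul, inv_mul_cancel₀ hpi.ne', one_smul] using h'
  have hre : Continuous fun v => (χ v).re := by fun_prop
  have him : Continuous fun v => (χ v).im := by fun_prop
  have hrec : HasCompactSupport fun v => (χ v).re := hχc.comp_left (g := Complex.re) rfl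
  have himc : HasCompactSupport fun v => (χ v).im := hχc.comp_left (g := Complex.im) rfl
  have hsplit : ∀ f : ℝ → X, Continuous f → ∫ v, χ v • f v =
      (∫ v, ((χ v).re : ℂ) • f v) + Complex.I • ∫ v, ((χ v).im : ℂ) • f v := by
    intro f hf
    have hint : ∀ ρ : ℝ → ℝ, Continuous ρ → HasCompactSupport ρ →
        Integrable fun v => (ρ v : ℂ) • f v := fun ρ hρ hρc =>
      Continuous.integrable_of_hasCompactSupport (by fun_prop)
        ((hρc.comp_left (g := Complex.ofReal) rfl).smul_right)
    have himI : Integrable fun v => Complex.I • ((χ v).im : ℂ) • f v :=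
      (hint _ him himc).smul Complex.I
    rw [← integral_smul, ← integral_add (hint _ hre hrec) himI]
    refine integral_congr_ae (.of_forall fun v => ?_)
    simp only [smul_smul, ← add_smul]
    rw [mul_comm, Complex.re_add_im]
  have hlimχ : Tendsto (fun ε : ℝ => ∫ v, χ v • 𝓕 (Gε ε) v) (𝓝[>] 0)
      (𝓝 (∫ v, χ v • F (2 * Real.pi * v))) := by
    rw [hsplit _ (by fun_prop)]
    refine ((hreal _ hre hrec).add ((hreal _ him himc).const_smul Complex.I)).congr' ?_
    filter_upwards [self_mem_nhdsWithin] with ε hε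
    exact (hsplit _ (hFcont ε hε)).symm
  have hswap : ∀ ε, 0 < ε → ∫ s, 𝓕 χ s • Gε ε s = ∫ v, χ v • 𝓕 (Gε ε) v := by
    intro ε hε
    have := VectorFourier.integral_fourierIntegral_smul_eq_flip (L := innerₗ ℝ)
      (μ := volume) (ν := volume) Real.continuous_fourierChar (by exact continuous_inner)
      (hχ.integrable_of_hasCompactSupport hχc) (hGint ε hε)
    rw [flip_innerₗ] at this
    exact this
  have hdom : Tendsto (fun ε : ℝ => ∫ s, 𝓕 χ s • Gε ε s) (𝓝[>] 0) (𝓝 (∫ s, 𝓕 χ s • G s)) := by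
    refine tendsto_integral_filter_of_dominated_convergence (fun s => ‖𝓕 χ s‖ * M) ?_ ?_
      (hχF.norm.mul_const M) ?_
    · filter_upwards [self_mem_nhdsWithin] with ε hε
      exact hχF.aestronglyMeasurable.smul (hGint ε hε).aestronglyMeasurable
    · filter_upwards [self_mem_nhdsWithin] with ε hε
      refine .of_forall fun s => ?_
      rw [norm_smul]
      gcongr
      by_cases hs : s ∈ Set.Ioi (0 : ℝ)
      · simp only [hGε, hG, Set.indicator_of_mem hs, norm_smul, Complex.norm_exp]
        refine (mul_le_of_le_one_left (norm_nonneg _) ?_).trans (hM s (le_of_lt hs))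
        have : 0 < ε * s := mul_pos hε hs
        simpa using this.le
      · simpa [hGε, hG, Set.indicator_of_notMem hs] using (norm_nonneg _).trans (hM 0 le_rfl)
    · refine .of_forall fun s => ?_
      have hc : Continuous fun ε : ℝ => 𝓕 χ s • Gε ε s := by
        simp only [hGε]; fun_prop
      have := (hc.tendsto 0).mono_left (nhdsWithin_le_nhds (s := Set.Ioi 0))
      simpa [hGε] using this
  refine tendsto_nhds_unique hdom (hlimχ.congr' ?_)
  filter_upwards [self_mem_nhdsWithin] with ε hε
  exact (hswap ε hε).symm

/-- A smooth compactly supported cutoff equal to `1` at the origin. -/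
lemma exists_cutoff : ∃ ψ : ℝ → ℂ, ContDiff ℝ ∞ ψ ∧ tsupport ψ ⊆ Set.Icc (-2) 2 ∧ ψ 0 = 1 := by
  let f : ContDiffBump (0 : ℝ) := ⟨1, 2, one_pos, one_lt_two⟩
  refine ⟨fun x => (f x : ℂ), Complex.ofRealCLM.contDiff.comp f.contDiff, ?_, ?_⟩
  · refine (tsupport_comp_subset (g := Complex.ofReal) rfl f).trans ?_
    rw [f.tsupport_eq, Real.closedBall_eq_Icc]
    simp [f]
  · simp [f.one_of_mem_closedBall (x := 0) (by simp [f])]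

end Ingham

/-- The extension by zero of a bounded Lipschitz function satisfies a Lipschitz estimate at every
point `t ≥ 1`. -/
lemma norm_sub_indicator_le {X : Type*} [NormedAddCommGroup X] {g : ℝ → X} {M : ℝ}
    (hM : ∀ t, 0 ≤ t → ‖g t‖ ≤ M) {L : NNReal} (hL : LipschitzOnWith L g (Set.Ici 0))
    {t : ℝ} (ht : 1 ≤ t) (s : ℝ) :
    ‖(Set.Ioi (0 : ℝ)).indicator g t - (Set.Ioi (0 : ℝ)).indicator g s‖ ≤ (L + M) * |s - t| := by
  have hM0 : 0 ≤ M := (norm_nonneg _).trans (hM 0 le_rfl)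
  rw [Set.indicator_of_mem (show t ∈ Set.Ioi (0 : ℝ) from by simp; linarith), add_mul]
  by_cases hs : s ∈ Set.Ioi (0 : ℝ)
  · rw [Set.indicator_of_mem hs]
    have := hL.dist_le_mul t (by simp; linarith) s (Set.Ioi_subset_Ici_self hs)
    rw [dist_eq_norm, Real.dist_eq, abs_sub_comm] at this
    have h2 : 0 ≤ M * |s - t| := by positivity
    linarith
  · rw [Set.indicator_of_notMem hs, sub_zero]
    have hs' : s ≤ 0 := by simpa using hs
    have h1 : 1 ≤ |s - t| := by
      rw [abs_sub_comm]; exact (by linarith : 1 ≤ t - s).trans (le_abs_self _)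
    have h2 : M ≤ M * |s - t| := le_mul_of_one_le_right hM0 h1
    have h3 : 0 ≤ (L : ℝ) * |s - t| := by positivity
    linarith [hM t (by linarith)]

open scoped FourierTransform in
/-- **Quantified Ingham theorem** (Theorem 1.3 of the paper).
Let `X` be a complex Banach space and `g : [0,∞) → X` bounded, continuous and Lipschitz.
Suppose the Laplace transform `ĝ(λ) = ∫₀^∞ e^{-λt} g(t) dt` admits a boundary function
`F : ℝ → X` (locally Bochner-integrable, with
`lim_{ε→0⁺} ∫ ĝ(ε+iη) ψ(η) dη = ∫ F(η) ψ(η) dη` for all continuous compactly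
supported `ψ`), that `F` is `k` times continuously differentiable and that
`‖F⁽ʲ⁾(η)‖ ≤ C` for all `η ∈ ℝ` and `0 ≤ j ≤ k`. Then there are `C' > 0` and `t₀ > 0`
with `‖g(t)‖ ≤ C'·t^{-k/2}` for all `t ≥ t₀`. -/
theorem quantified_ingham
    {X : Type*} [NormedAddCommGroup X] [NormedSpace ℂ X] [CompleteSpace X]
    (g : ℝ → X)
    (hg_bdd : ∃ M : ℝ, ∀ t : ℝ, 0 ≤ t → ‖g t‖ ≤ M)
    (hg_cont : ContinuousOn g (Set.Ici 0))
    (hg_lip : ∃ L : NNReal, LipschitzOnWith L g (Set.Ici 0))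
    (F : ℝ → X)
    (hF : LocallyIntegrable F MeasureTheory.volume)
    (hlim : ∀ ψ : ℝ → ℝ, Continuous ψ → HasCompactSupport ψ →
      Tendsto
        (fun ε : ℝ => ∫ η : ℝ, (ψ η : ℂ) •
          (∫ t in Set.Ioi (0 : ℝ),
            Complex.exp (-((ε : ℂ) + (η : ℂ) * Complex.I) * (t : ℂ)) • g t))
        (nhdsWithin 0 (Set.Ioi 0))
        (nhds (∫ η : ℝ, (ψ η : ℂ) • F η)))
    (k : ℕ) (hFk : ContDiff ℝ k F)
    (C : ℝ) (hC : 0 < C)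
    (hFder : ∀ j : ℕ, j ≤ k → ∀ η : ℝ, ‖iteratedDeriv j F η‖ ≤ C) :
    ∃ C' > (0 : ℝ), ∃ t₀ > (0 : ℝ), ∀ t : ℝ, t₀ ≤ t →
      ‖g t‖ ≤ C' * t ^ (-(k : ℝ) / 2) := by
  obtain ⟨M, hM⟩ := hg_bdd
  obtain ⟨L, hL⟩ := hg_lip
  obtain ⟨ψ, hψ, hψs, hψ0⟩ := exists_cutoff
  have hM0 : 0 ≤ M := (norm_nonneg _).trans (hM 0 le_rfl)
  have hψc : HasCompactSupport ψ :=
    isCompact_Icc.of_isClosed_subset (isClosed_tsupport ψ) hψs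
  have hG : AEStronglyMeasurable ((Set.Ioi (0 : ℝ)).indicator g) :=
    (aestronglyMeasurable_indicator_iff measurableSet_Ioi).2
      ((hg_cont.mono Set.Ioi_subset_Ici_self).aestronglyMeasurable measurableSet_Ioi)
  have hGM : ∀ s, ‖(Set.Ioi (0 : ℝ)).indicator g s‖ ≤ M := fun s => by
    by_cases hs : s ∈ Set.Ioi (0 : ℝ)
    · rw [Set.indicator_of_mem hs]; exact hM s (le_of_lt hs)
    · rw [Set.indicator_of_notMem hs, norm_zero]; exact hM0
  set φ : SchwartzMap ℝ ℂ := 𝓕 (hψc.toSchwartzMap hψ) with hφdef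
  have hφ : (φ : ℝ → ℂ) = 𝓕 ψ := by
    rw [hφdef, SchwartzMap.fourier_coe]; rfl
  have hone : ∫ u, φ u = 1 := by
    have h := congrFun (hψ.continuous.fourierInv_fourier_eq
      (hψ.continuous.integrable_of_hasCompactSupport hψc) (hφ ▸ φ.integrable)) 0
    rw [hψ0, Real.fourierInv_eq'] at h
    simpa [hφ] using h
  have hφ1 : Integrable fun u : ℝ => |u| * ‖φ u‖ := by
    simpa using φ.integrable_pow_mul volume 1
  have hF₁ : ContDiff ℝ k fun v : ℝ => F (2 * Real.pi * v) := by fun_prop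
  have hF₁b : ∀ j ≤ k, ∀ v,
      ‖iteratedDeriv j (fun v : ℝ => F (2 * Real.pi * v)) v‖ ≤ (2 * Real.pi) ^ k * C := by
    intro j hj v
    rw [iteratedDeriv_comp_const_smul (hFk.of_le (by exact_mod_cast hj)), norm_smul, norm_pow,
      Real.norm_eq_abs, abs_of_pos (by positivity)]
    have h1 : (1 : ℝ) ≤ 2 * Real.pi := by linarith [Real.pi_gt_three]
    gcongr
    exact hFder j hj _
  obtain ⟨D, hD⟩ := exists_norm_iteratedDeriv_dilate_smul_le hψ hψc hF₁ hF₁b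
  have hD0 : 0 ≤ D := (norm_nonneg _).trans (hD 1 le_rfl 0)
  set K := ∫ u, |u| * ‖φ u‖ with hK
  have hK0 : 0 ≤ K := integral_nonneg fun u => by positivity
  refine ⟨(L + M) * K + 4 * D + 1, by positivity, 1, one_pos, fun t ht => ?_⟩
  have ht0 : 0 < t := by linarith
  set R : ℝ := t ^ ((k : ℝ) / 2) with hRdef
  have hR : 1 ≤ R := Real.one_le_rpow ht (by positivity)
  have hR0 : 0 < R := by linarith
  have hRR : R * R = t ^ k := by
    rw [hRdef, ← Real.rpow_add ht0, add_halves, Real.rpow_natCast]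
  have hRinv : t ^ (-(k : ℝ) / 2) = R⁻¹ := by
    rw [neg_div, Real.rpow_neg ht0.le]
  have hψRc : HasCompactSupport fun v : ℝ => ψ (v / R) :=
    hψc.comp_homeomorph (Homeomorph.mulRight₀ R⁻¹ (by positivity))
  have hχF : 𝓕 (fun v : ℝ => Real.fourierChar (v * t) • ψ (v / R))
      = fun s => R • φ (R * (s - t)) := by
    ext s; rw [fourier_modulate_dilate ψ hR0, hφ]
  have hid := integral_fourier_smul_indicator_eq hM hG hFk.continuous hlim
    (χ := fun v : ℝ => Real.fourierChar (v * t) • ψ (v / R))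
    ((Real.continuous_fourierChar.comp (by fun_prop)).smul (hψ.continuous.comp (by fun_prop)))
    hψRc.smul_left
    (by rw [hχF]; exact ((φ.integrable.comp_mul_left' hR0.ne').comp_sub_right t).smul R)
  have hfar : (∫ v, (Real.fourierChar (v * t) • ψ (v / R)) • F (2 * Real.pi * v))
      = 𝓕 (fun v : ℝ => ψ (v / R) • F (2 * Real.pi * v)) (-t) := by
    rw [Real.fourier_real_eq]
    refine integral_congr_ae (.of_forall fun v => ?_)
    simp only [mul_neg, neg_neg, smul_assoc]
  have hsupp : tsupport (fun v : ℝ => ψ (v / R) • F (2 * Real.pi * v))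
      ⊆ Set.Icc (-(2 * R)) (2 * R) := by
    refine closure_minimal (fun v hv => ?_) isClosed_Icc
    have hv' : ψ (v / R) ≠ 0 := fun h => hv (by simp [h])
    have := hψs (subset_tsupport ψ hv')
    rw [Set.mem_Icc, le_div_iff₀ hR0, div_le_iff₀ hR0] at this
    exact ⟨by linarith [this.1], this.2⟩
  have hdecay := norm_fourier_le_of_norm_iteratedDeriv_le
    (H := fun v : ℝ => ψ (v / R) • F (2 * Real.pi * v))
    (ContDiff.smul ((hψ.of_le (by exact_mod_cast le_top)).comp (contDiff_id.div_const R)) hF₁)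
    (by positivity) hsupp (hD R hR) (-t)
  have hmain : ‖∫ s, (R • φ (R * (s - t))) • (Set.Ioi (0 : ℝ)).indicator g s‖ ≤ 4 * D / R := by
    rw [hχF] at hid
    rw [hid, hfar, le_div_iff₀ hR0]
    have h1 : t ^ k ≤ |2 * Real.pi * -t| ^ k := by
      gcongr
      rw [mul_neg, abs_neg, abs_of_pos (by positivity)]
      nlinarith [Real.pi_gt_three]
    have h2 := (mul_le_mul_of_nonneg_right h1 (norm_nonneg _)).trans hdecay
    rw [← hRR] at h2
    refine le_of_mul_le_mul_left ?_ hR0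
    linarith
  have happrox := norm_sub_integral_dilate_le φ.integrable hφ1 hone hG hGM
    (norm_sub_indicator_le hM hL ht) hR0
  rw [Set.indicator_of_mem (show t ∈ Set.Ioi (0 : ℝ) from ht0)] at happrox
  rw [hRinv, ← div_eq_mul_inv]
  calc ‖g t‖ ≤ (L + M) * K / R + 4 * D / R := by
        have := norm_le_norm_sub_add (g t)
          (∫ s, (R • φ (R * (s - t))) • (Set.Ioi (0 : ℝ)).indicator g s)
        linarith
    _ ≤ ((L + M) * K + 4 * D + 1) / R := by
        rw [← add_div]; exact div_le_div_of_nonneg_right (by linarith) hR0.le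
end

section
/- (Lemma 4.3 of the paper: boundary function of the free transport resolvent.) Let Ω ⊆ ℝ^d be a bounded open set, let m be a Borel measure on ℝ^d, let k ∈ ℕ and η ∈ ℝ, and let f : Ω × ℝ^d → ℂ be measurable with ∫_{ℝ^d} ∫_Ω max(1,|v|^{−(k+1)}) |f(x,v)| dx m(dv) < ∞. Then lim_{ε→0⁺} ∫_{ℝ^d} ∫_Ω max(1,|v|^{−k}) · | ∫₀^{t₋(x,v)} ( e^{−(ε+iη)t} − e^{−iηt} ) f(x − t·v, v) dt | dx m(dv) = 0. In particular, the free-transport resolvent R(ε+iη,T₀)f(x,v) = ∫₀^{t₋(x,v)} e^{−(ε+iη)t} f(x−t·v,v) dt converges, as ε→0⁺, in the weighted L¹-norm with weight max(1,|v|^{−k}) to the boundary function R⁰_f(η)(x,v) = ∫₀^{t₋(x,v)} e^{−iηt} f(x−t·v,v) dt. -/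
open MeasureTheory Filter

/-- Forward exit time: `t₊(x,v) = inf {s > 0 : x + s·v ∉ Ω}`. -/
noncomputable def tPlus {d : ℕ} (Ω : Set (EuclideanSpace ℝ (Fin d)))
    (x v : EuclideanSpace ℝ (Fin d)) : ℝ :=
  sInf {s : ℝ | 0 < s ∧ x + s • v ∉ Ω}

/-- Backward exit time: `t₋(x,v) = inf {s > 0 : x − s·v ∉ Ω}`. -/
noncomputable def tMinus {d : ℕ} (Ω : Set (EuclideanSpace ℝ (Fin d)))
    (x v : EuclideanSpace ℝ (Fin d)) : ℝ :=
  sInf {s : ℝ | 0 < s ∧ x - s • v ∉ Ω}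

theorem sub_smul_mem_of_lt_tMinus {d : ℕ} {Ω : Set (EuclideanSpace ℝ (Fin d))}
    {x v : EuclideanSpace ℝ (Fin d)} {t : ℝ} (ht : t ∈ Set.Ioo 0 (tMinus Ω x v)) :
    x - t • v ∈ Ω := by
  by_contra h
  have hle : tMinus Ω x v ≤ t := csInf_le ⟨0, fun s hs => hs.1.le⟩ ⟨ht.1, h⟩
  exact absurd ht.2 hle.not_gt

theorem tMinus_zero_right {d : ℕ} {Ω : Set (EuclideanSpace ℝ (Fin d))}
    {x : EuclideanSpace ℝ (Fin d)} (hx : x ∈ Ω) : tMinus Ω x 0 = 0 := by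
  simp [tMinus, hx]

/-- Along a trajectory that stays in `Ω`, the elapsed time is at most `diam Ω / ‖v‖`. -/
theorem le_diam_div_norm_of_lt_tMinus {d : ℕ} {Ω : Set (EuclideanSpace ℝ (Fin d))}
    (hΩb : Bornology.IsBounded Ω) {x v : EuclideanSpace ℝ (Fin d)} (hx : x ∈ Ω) (hv : v ≠ 0)
    {t : ℝ} (ht : t ∈ Set.Ioo 0 (tMinus Ω x v)) : t ≤ Metric.diam Ω / ‖v‖ := by
  rw [le_div_iff₀ (norm_pos_iff.2 hv)]
  have h := Metric.dist_le_diam_of_mem hΩb hx (sub_smul_mem_of_lt_tMinus ht)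
  rwa [dist_eq_norm, sub_sub_cancel, norm_smul, Real.norm_of_nonneg ht.1.le] at h

theorem norm_exp_sub_exp_le {ε t : ℝ} (η : ℝ) (hε : 0 ≤ ε) (ht : 0 ≤ t) :
    ‖Complex.exp (-((ε : ℂ) + (η : ℂ) * Complex.I) * (t : ℂ)) -
      Complex.exp (-((η : ℂ) * Complex.I) * (t : ℂ))‖ ≤ min 1 (ε * t) := by
  have hfac : Complex.exp (-((ε : ℂ) + (η : ℂ) * Complex.I) * (t : ℂ)) -
      Complex.exp (-((η : ℂ) * Complex.I) * (t : ℂ)) =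
      ((Real.exp (-(ε * t)) - 1 : ℝ) : ℂ) * Complex.exp ((-(η * t) : ℝ) * Complex.I) := by
    push_cast
    rw [sub_mul, ← Complex.exp_add, one_mul]
    ring_nf
  have hle : Real.exp (-(ε * t)) ≤ 1 := Real.exp_le_one_iff.2 (by nlinarith [mul_nonneg hε ht])
  rw [hfac, norm_mul, Complex.norm_exp_ofReal_mul_I, mul_one, Complex.norm_real, Real.norm_eq_abs,
    abs_of_nonpos (by linarith)]
  have h1 := Real.add_one_le_exp (-(ε * t))
  have h2 := Real.exp_pos (-(ε * t))
  exact le_min (by linarith) (by linarith)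

/-- Integrating a nonnegative function along straight lines for a time `τ` multiplies
its integral by `τ`. -/
theorem lintegral_lintegral_sub_smul {E : Type*} [NormedAddCommGroup E] [NormedSpace ℝ E]
    [MeasurableSpace E] [BorelSpace E] [SecondCountableTopology E]
    (μ : Measure E) [SFinite μ] [μ.IsAddRightInvariant]
    {g : E → ENNReal} (hg : Measurable g) (v : E) (τ : ℝ) :
    ∫⁻ x, (∫⁻ t in Set.Ioo (0 : ℝ) τ, g (x - t • v)) ∂μ = ENNReal.ofReal τ * ∫⁻ x, g x ∂μ := by
  have hmeas : Measurable (Function.uncurry fun (x : E) (t : ℝ) => g (x - t • v)) :=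
    hg.comp (by fun_prop)
  rw [lintegral_lintegral_swap hmeas.aemeasurable]
  simp_rw [lintegral_sub_right_eq_self g]
  rw [setLIntegral_const, Real.volume_Ioo, sub_zero, mul_comm]

theorem max_one_inv_pow_mul_inv_le {r : ℝ} (hr : 0 < r) (k : ℕ) :
    max 1 ((r ^ k)⁻¹) * r⁻¹ ≤ max 1 ((r ^ (k + 1))⁻¹) := by
  rw [max_mul_of_nonneg _ _ (by positivity), one_mul, ← mul_inv, ← pow_succ]
  refine max_le ?_ (le_max_right _ _)
  rcases le_total 1 r with h | h
  · exact le_max_of_le_left (inv_le_one_of_one_le₀ h)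
  · refine le_max_of_le_right (inv_anti₀ (by positivity) ?_)
    simpa using pow_le_pow_of_le_one hr.le h (Nat.succ_le_succ (Nat.zero_le k))

/-- For a fixed velocity, the weighted `L¹`-distance of the resolvent from its boundary function
is at most `diam Ω · max(1,|v|^{−(k+1)}) · min(1, ε · diam Ω / |v|) · ∫_Ω |f(x,v)| dx`. -/
theorem lintegral_resolvent_sub_boundary_le {d : ℕ}
    {Ω : Set (EuclideanSpace ℝ (Fin d))} (hΩo : IsOpen Ω) (hΩb : Bornology.IsBounded Ω)
    (k : ℕ) (η : ℝ) (v : EuclideanSpace ℝ (Fin d))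
    {g : EuclideanSpace ℝ (Fin d) → ℂ} (hg : Measurable g) {ε : ℝ} (hε : 0 ≤ ε) :
    (∫⁻ x in Ω, ENNReal.ofReal (max 1 ((‖v‖ ^ k)⁻¹) *
      ‖∫ t in Set.Ioo (0 : ℝ) (tMinus Ω x v),
          (Complex.exp (-((ε : ℂ) + (η : ℂ) * Complex.I) * (t : ℂ)) -
            Complex.exp (-((η : ℂ) * Complex.I) * (t : ℂ))) * g (x - t • v)‖)) ≤
      ENNReal.ofReal (min 1 (ε * (Metric.diam Ω / ‖v‖))) *
        (ENNReal.ofReal (Metric.diam Ω) *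
          ∫⁻ x in Ω, ENNReal.ofReal (max 1 ((‖v‖ ^ (k + 1))⁻¹) * ‖g x‖)) := by
  have hD : 0 ≤ Metric.diam Ω := Metric.diam_nonneg
  rcases eq_or_ne v 0 with rfl | hv
  · rw [setLIntegral_congr_fun (g := fun _ => 0) hΩo.measurableSet
      fun x hx => by simp [tMinus_zero_right hx]]
    simp
  have hr : 0 < ‖v‖ := norm_pos_iff.2 hv
  set τ : ℝ := Metric.diam Ω / ‖v‖ with hτ
  have hτ0 : 0 ≤ τ := by positivity
  set c : ℝ := min 1 (ε * τ)
  set w : ℝ := max 1 ((‖v‖ ^ k)⁻¹)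
  have hw0 : 0 ≤ w := zero_le_one.trans (le_max_left _ _)
  set G : EuclideanSpace ℝ (Fin d) → ENNReal := Ω.indicator fun y => ‖g y‖ₑ with hG
  have hGm : Measurable G := hg.enorm.indicator hΩo.measurableSet
  have hpt : ∀ x ∈ Ω, ENNReal.ofReal (w * ‖∫ t in Set.Ioo (0 : ℝ) (tMinus Ω x v),
      (Complex.exp (-((ε : ℂ) + (η : ℂ) * Complex.I) * (t : ℂ)) -
        Complex.exp (-((η : ℂ) * Complex.I) * (t : ℂ))) * g (x - t • v)‖) ≤
      ENNReal.ofReal w * ENNReal.ofReal c * ∫⁻ t in Set.Icc (0 : ℝ) τ, G (x - t • v) := by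
    intro x hx
    rw [ENNReal.ofReal_mul hw0, ofReal_norm, mul_assoc]
    gcongr
    refine (enorm_integral_le_lintegral_enorm _).trans ?_
    rw [← lintegral_const_mul' _ _ ENNReal.ofReal_ne_top]
    refine (setLIntegral_mono' measurableSet_Ioo fun t ht => ?_).trans
      (lintegral_mono_set fun t ht => ⟨ht.1.le, le_diam_div_norm_of_lt_tMinus hΩb hx hv ht⟩)
    rw [enorm_mul, hG, Set.indicator_of_mem (sub_smul_mem_of_lt_tMinus ht)]
    gcongr
    rw [← ofReal_norm]
    refine ENNReal.ofReal_le_ofReal ((norm_exp_sub_exp_le η hε ht.1.le).trans ?_)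
    exact min_le_min_left _
      (mul_le_mul_of_nonneg_left (le_diam_div_norm_of_lt_tMinus hΩb hx hv ht) hε)
  calc
    _ ≤ ∫⁻ x in Ω, ENNReal.ofReal w * ENNReal.ofReal c *
          ∫⁻ t in Set.Icc (0 : ℝ) τ, G (x - t • v) :=
      setLIntegral_mono' hΩo.measurableSet hpt
    _ ≤ ∫⁻ x, ENNReal.ofReal w * ENNReal.ofReal c *
          ∫⁻ t in Set.Ioo (0 : ℝ) τ, G (x - t • v) := by
      simp_rw [setLIntegral_congr Ioo_ae_eq_Icc]
      exact setLIntegral_le_lintegral _ _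
    _ = ENNReal.ofReal c * (ENNReal.ofReal (w * τ) * ∫⁻ x in Ω, ‖g x‖ₑ) := by
      rw [lintegral_const_mul' _ _ (by finiteness), lintegral_lintegral_sub_smul _ hGm, hG,
        lintegral_indicator hΩo.measurableSet, ENNReal.ofReal_mul hw0]
      ring
    _ ≤ ENNReal.ofReal c * (ENNReal.ofReal (Metric.diam Ω * max 1 ((‖v‖ ^ (k + 1))⁻¹)) *
          ∫⁻ x in Ω, ‖g x‖ₑ) := by
      refine mul_le_mul_right (mul_le_mul_left (ENNReal.ofReal_le_ofReal ?_) _) _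
      calc w * τ = Metric.diam Ω * (w * ‖v‖⁻¹) := by rw [hτ]; ring
        _ ≤ _ := mul_le_mul_of_nonneg_left (max_one_inv_pow_mul_inv_le hr k) hD
    _ = _ := by
      rw [ENNReal.ofReal_mul hD, mul_assoc, ← lintegral_const_mul' _ _ ENNReal.ofReal_ne_top]
      simp_rw [ENNReal.ofReal_mul (zero_le_one.trans (le_max_left (1 : ℝ) _)), ofReal_norm]

/-- **Lemma 4.3 of the paper: boundary function of the free transport resolvent.**
If `∫∫ max(1,|v|^{−(k+1)}) |f(x,v)| dx m(dv) < ∞`, then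
`∫∫ max(1,|v|^{−k}) | ∫₀^{t₋(x,v)} (e^{−(ε+iη)t} − e^{−iηt}) f(x − t·v, v) dt | dx m(dv) → 0`
as `ε → 0⁺`; i.e. the free-transport resolvent `R(ε+iη,T₀)f` converges in the weighted
`L¹`-norm with weight `max(1,|v|^{−k})` to its boundary function `R⁰_f(η)`. -/
theorem boundary_function_free_transport {d : ℕ}
    (Ω : Set (EuclideanSpace ℝ (Fin d))) (hΩo : IsOpen Ω) (hΩb : Bornology.IsBounded Ω)
    (m : Measure (EuclideanSpace ℝ (Fin d)))
    (k : ℕ) (η : ℝ)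
    (f : EuclideanSpace ℝ (Fin d) → EuclideanSpace ℝ (Fin d) → ℂ)
    (hf : Measurable (Function.uncurry f))
    (hint : (∫⁻ v, (∫⁻ x in Ω,
        ENNReal.ofReal (max 1 ((‖v‖ ^ (k + 1))⁻¹) * ‖f x v‖)) ∂m) < ⊤) :
    Tendsto (fun ε : ℝ =>
        ∫⁻ v, (∫⁻ x in Ω, ENNReal.ofReal (max 1 ((‖v‖ ^ k)⁻¹) *
          ‖∫ t in Set.Ioo (0 : ℝ) (tMinus Ω x v),
              (Complex.exp (-((ε : ℂ) + (η : ℂ) * Complex.I) * (t : ℂ)) -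
                Complex.exp (-((η : ℂ) * Complex.I) * (t : ℂ))) * f (x - t • v) v‖)) ∂m)
      (nhdsWithin 0 (Set.Ioi 0)) (nhds 0) := by
  set B : EuclideanSpace ℝ (Fin d) → ENNReal := fun v => ENNReal.ofReal (Metric.diam Ω) *
    ∫⁻ x in Ω, ENNReal.ofReal (max 1 ((‖v‖ ^ (k + 1))⁻¹) * ‖f x v‖) with hB
  have hBm : Measurable B := by
    refine Measurable.const_mul (Measurable.lintegral_prod_left'
      (f := fun p : EuclideanSpace ℝ (Fin d) × EuclideanSpace ℝ (Fin d) =>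
        ENNReal.ofReal (max 1 ((‖p.2‖ ^ (k + 1))⁻¹) * ‖f p.1 p.2‖)) ?_) _
    have hf' : Measurable fun p : EuclideanSpace ℝ (Fin d) × EuclideanSpace ℝ (Fin d) =>
      f p.1 p.2 := hf
    fun_prop
  have hBint : ∫⁻ v, B v ∂m ≠ ⊤ := by
    rw [hB, lintegral_const_mul' _ _ ENNReal.ofReal_ne_top]
    exact ENNReal.mul_ne_top ENNReal.ofReal_ne_top hint.ne
  have hlim : Tendsto (fun ε : ℝ => ∫⁻ v, ENNReal.ofReal (min 1 (ε * (Metric.diam Ω / ‖v‖))) * B v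
      ∂m) (nhdsWithin 0 (Set.Ioi 0)) (nhds (∫⁻ _, 0 ∂m)) := by
    refine tendsto_lintegral_filter_of_dominated_convergence B
      (Eventually.of_forall fun ε => by fun_prop)
      (Eventually.of_forall fun ε => Eventually.of_forall fun v => ?_) hBint ?_
    · exact mul_le_of_le_one_left' (ENNReal.ofReal_le_one.2 (min_le_left _ _))
    · filter_upwards [ae_lt_top hBm hBint] with v hv
      have hcont : Continuous fun ε : ℝ => ENNReal.ofReal (min 1 (ε * (Metric.diam Ω / ‖v‖))) :=
        ENNReal.continuous_ofReal.comp (by fun_prop)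
      have hzero := (hcont.tendsto 0).mono_left (nhdsWithin_le_nhds (s := Set.Ioi 0))
      simpa using ENNReal.Tendsto.mul_const hzero (Or.inr hv.ne)
  rw [lintegral_zero] at hlim
  refine tendsto_of_tendsto_of_tendsto_of_le_of_le' tendsto_const_nhds hlim
    (Eventually.of_forall fun _ => zero_le) ?_
  filter_upwards [self_mem_nhdsWithin] with ε hε
  refine lintegral_mono fun v => ?_
  have hfv : Measurable fun x => f x v := hf.of_uncurry_right
  exact lintegral_resolvent_sub_boundary_le hΩo hΩb k η v hfv (le_of_lt hε)
end
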